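/- Let k, l ≥ 1, A ∈ ℝ^{l×k}, b ∈ ℝ^l, d ∈ ℝ^k and ε ≥ 0, and let Δ_k be the probability simplex in ℝ^k. Assume there exists x ∈ Δ_k with Ax = b. Let x̃ ∈ Δ_k satisfy ⟨d, x̃⟩ + 23‖d‖_∞ ‖Ax̃ − b‖₁ ≤ inf_{x ∈ Δ_k} (⟨d, x⟩ + 23‖d‖_∞ ‖Ax − b‖₁) + ε, and let x̄ ∈ Δ_k satisfy Ax̄ = b and ‖x̃ − x̄‖₁ ≤ 23·‖Ax̃ − b‖₁. Then ⟨d, x̄⟩ ≤ inf_{x ∈ Δ_k, Ax = b} ⟨d, x⟩ + ε. -/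

import Mathlib

/-- Hölder's inequality for the ℓ1 and sup norms on `ι → ℝ`. -/
theorem sum_mul_le_norm_mul_sum_abs {ι : Type*} [Fintype ι] (d v : ι → ℝ) :
    ∑ i, d i * v i ≤ ‖d‖ * ∑ i, |v i| := by
  rw [Finset.mul_sum]
  refine Finset.sum_le_sum fun i _ => (le_abs_self _).trans ?_
  rw [abs_mul]
  exact mul_le_mul_of_nonneg_right (norm_le_pi_norm d i) (abs_nonneg _)

/-- A linear functional is bounded below on the standard simplex by minus the sup norm
of its coefficients. -/
theorem neg_norm_le_sum_mul_of_mem_stdSimplex {ι : Type*} [Fintype ι] (d : ι → ℝ)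
    {x : ι → ℝ} (hx : x ∈ stdSimplex ℝ ι) : -‖d‖ ≤ ∑ i, d i * x i := by
  have h := sum_mul_le_norm_mul_sum_abs (-d) x
  have habs : ∑ i, |x i| = 1 := by
    rw [← hx.2]
    exact Finset.sum_congr rfl fun i _ => abs_of_nonneg (hx.1 i)
  simp only [Pi.neg_apply, neg_mul, Finset.sum_neg_distrib, norm_neg, habs, mul_one] at h
  linarith

/-- Second claim of the ℓ1-penalization lemma: any ε-approximate minimizer of
the penalized objective rounds (via Round-POT) to an ε-approximate solution of
the constrained POT problem.  Here ‖d‖ is the sup norm of d : Fin k → ℝ. -/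
theorem stmt_15 (k l : ℕ) (hk : 1 ≤ k) (hl : 1 ≤ l)
    (A : Matrix (Fin l) (Fin k) ℝ) (b : Fin l → ℝ) (d : Fin k → ℝ)
    (ε : ℝ) (hε : 0 ≤ ε)
    (hfeas : ∃ x ∈ stdSimplex ℝ (Fin k), A.mulVec x = b)
    (xt : Fin k → ℝ) (hxt : xt ∈ stdSimplex ℝ (Fin k))
    (hxtapprox : (∑ i, d i * xt i) + 23 * ‖d‖ * (∑ i, |A.mulVec xt i - b i|)
      ≤ sInf {w : ℝ | ∃ x ∈ stdSimplex ℝ (Fin k),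
          w = (∑ i, d i * x i) + 23 * ‖d‖ * ∑ i, |A.mulVec x i - b i|} + ε)
    (xb : Fin k → ℝ) (hxb : xb ∈ stdSimplex ℝ (Fin k))
    (hxbfeas : A.mulVec xb = b)
    (hxbclose : (∑ i, |xt i - xb i|) ≤ 23 * ∑ i, |A.mulVec xt i - b i|) :
    (∑ i, d i * xb i)
      ≤ sInf {w : ℝ | ∃ x ∈ stdSimplex ℝ (Fin k),
          A.mulVec x = b ∧ w = ∑ i, d i * x i} + ε := by
  have hround : ∑ i, d i * xb i ≤
      (∑ i, d i * xt i) + 23 * ‖d‖ * ∑ i, |A.mulVec xt i - b i| := by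
    have h := sum_mul_le_norm_mul_sum_abs d (xb - xt)
    simp only [Pi.sub_apply, mul_sub, Finset.sum_sub_distrib, abs_sub_comm (xb _)] at h
    linarith [mul_le_mul_of_nonneg_left hxbclose (norm_nonneg d)]
  have hbdd : BddBelow {w : ℝ | ∃ x ∈ stdSimplex ℝ (Fin k),
      w = (∑ i, d i * x i) + 23 * ‖d‖ * ∑ i, |A.mulVec x i - b i|} := by
    refine ⟨-‖d‖, ?_⟩
    rintro w ⟨x, hx, rfl⟩
    have hpen : 0 ≤ 23 * ‖d‖ * ∑ i, |A.mulVec x i - b i| := by positivity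
    linarith [neg_norm_le_sum_mul_of_mem_stdSimplex d hx]
  refine (hround.trans hxtapprox).trans (add_le_add_left ?_ ε)
  obtain ⟨x₀, hx₀, hAx₀⟩ := hfeas
  refine le_csInf ⟨_, x₀, hx₀, hAx₀, rfl⟩ ?_
  rintro w ⟨x, hx, hAx, rfl⟩
  exact csInf_le hbdd ⟨x, hx, by simp [hAx]⟩
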